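/- Let (X,d) be a compact metric space with at least two points and let (X, f_{1,∞}) be a minimal non-autonomous discrete system such that f_{1,∞} is feeble open, each f_n is surjective, (f_n) converges uniformly to a continuous map f : X → X, and the compositions (f_r^k) converge collectively to (f^k). If f_{1,∞} is multi-transitive, then f_{1,∞} is Li-Yorke chaotic: there exists an uncountable set S ⊆ X such that for all distinct x, y ∈ S, liminf_{n→∞} d(f_1^n(x), f_1^n(y)) = 0 and limsup_{n→∞} d(f_1^n(x), f_1^n(y)) > 0. -/

import Mathlib

open Set Filter

/-- `nds f i n` is the `n`-step composition `f_i^n = f (i+n-1) ∘ ⋯ ∘ f i`, with `nds f i 0 = id`. -/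
def nds {X : Type*} (f : ℕ → X → X) (i : ℕ) : ℕ → X → X
  | 0 => id
  | n + 1 => f (i + n) ∘ nds f i n

section TopDefs

variable {X : Type*} [TopologicalSpace X]

/-- The NDS `f_{1,∞}` is (topologically) transitive. -/
def NDSTransitive (f : ℕ → X → X) : Prop :=
  ∀ U V : Set X, IsOpen U → U.Nonempty → IsOpen V → V.Nonempty →
    ∃ n : ℕ, 0 < n ∧ (nds f 1 n '' U ∩ V).Nonempty

/-- The NDS `f_{1,∞}` is mixing. -/
def NDSMixing (f : ℕ → X → X) : Prop :=
  ∀ U V : Set X, IsOpen U → U.Nonempty → IsOpen V → V.Nonempty →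
    ∃ N : ℕ, ∀ n : ℕ, N ≤ n → (nds f 1 n '' U ∩ V).Nonempty

/-- The NDS `f_{1,∞}` is weakly mixing. -/
def NDSWeaklyMixing (f : ℕ → X → X) : Prop :=
  ∀ U₁ U₂ V₁ V₂ : Set X, IsOpen U₁ → U₁.Nonempty → IsOpen U₂ → U₂.Nonempty →
    IsOpen V₁ → V₁.Nonempty → IsOpen V₂ → V₂.Nonempty →
    ∃ n : ℕ, 0 < n ∧ (nds f 1 n '' U₁ ∩ V₁).Nonempty ∧ (nds f 1 n '' U₂ ∩ V₂).Nonempty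

/-- The NDS `f_{1,∞}` is multi-transitive. -/
def NDSMultiTransitive (f : ℕ → X → X) : Prop :=
  ∀ m : ℕ, 0 < m → ∀ U V : Fin m → Set X,
    (∀ j, IsOpen (U j)) → (∀ j, (U j).Nonempty) →
    (∀ j, IsOpen (V j)) → (∀ j, (V j).Nonempty) →
    ∃ l : ℕ, 0 < l ∧ ∀ j : Fin m, (nds f 1 (l * (j.1 + 1)) '' U j ∩ V j).Nonempty

/-- The NDS `f_{1,∞}` is totally transitive. -/
def NDSTotallyTransitive (f : ℕ → X → X) : Prop :=
  ∀ k : ℕ, 0 < k → ∀ U V : Set X, IsOpen U → U.Nonempty → IsOpen V → V.Nonempty →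
    ∃ n : ℕ, 0 < n ∧ (nds f 1 (n * k) '' U ∩ V).Nonempty

/-- The NDS `f_{1,∞}` is minimal: every orbit is dense. -/
def NDSMinimal (f : ℕ → X → X) : Prop :=
  ∀ x : X, Dense (Set.range fun n : ℕ => nds f 1 n x)

/-- The NDS `f_{1,∞}` is feeble open. -/
def FeebleOpen (f : ℕ → X → X) : Prop :=
  ∀ i : ℕ, 1 ≤ i → ∀ U : Set X, IsOpen U → U.Nonempty → (interior (f i '' U)).Nonempty

/-- A set of positive integers is syndetic (has bounded gaps). -/
def SyndeticSet (A : Set ℕ) : Prop :=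
  ∃ M : ℕ, ∀ i : ℕ, 1 ≤ i → ∃ j ∈ A, i ≤ j ∧ j ≤ i + M

/-- A set of positive integers is thick (contains arbitrarily long runs). -/
def ThickSet (A : Set ℕ) : Prop :=
  ∀ p : ℕ, ∃ n : ℕ, ∀ j : ℕ, n ≤ j → j ≤ n + p → j ∈ A

/-- The NDS `f_{1,∞}` is syndetically transitive. -/
def NDSSyndeticallyTransitive (f : ℕ → X → X) : Prop :=
  ∀ U V : Set X, IsOpen U → U.Nonempty → IsOpen V → V.Nonempty →
    SyndeticSet {n : ℕ | 0 < n ∧ (nds f 1 n '' U ∩ V).Nonempty}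

/-- The NDS `f_{1,∞}` has dense periodic points. -/
def NDSDensePeriodicPoints (f : ℕ → X → X) : Prop :=
  Dense {x : X | ∃ k : ℕ, 0 < k ∧ ∀ n : ℕ, 0 < n → nds f 1 (k * n) x = x}

/-- The NDS `f_{k,∞}` is strongly transitive. -/
def NDSStronglyTransitiveFrom (f : ℕ → X → X) (k : ℕ) : Prop :=
  ∀ U : Set X, IsOpen U → U.Nonempty →
    ∃ M : ℕ, 0 < M ∧ (⋃ i ∈ Set.Icc 1 M, nds f k i '' U) = Set.univ

/-- An autonomous map is transitive. -/
def MapTransitive {Y : Type*} [TopologicalSpace Y] (g : Y → Y) : Prop :=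
  ∀ U V : Set Y, IsOpen U → U.Nonempty → IsOpen V → V.Nonempty →
    ∃ n : ℕ, 0 < n ∧ (g^[n] '' U ∩ V).Nonempty

/-- An autonomous map is weakly mixing. -/
def MapWeaklyMixing {Y : Type*} [TopologicalSpace Y] (g : Y → Y) : Prop :=
  ∀ U₁ U₂ V₁ V₂ : Set Y, IsOpen U₁ → U₁.Nonempty → IsOpen U₂ → U₂.Nonempty →
    IsOpen V₁ → V₁.Nonempty → IsOpen V₂ → V₂.Nonempty →
    ∃ n : ℕ, 0 < n ∧ (g^[n] '' U₁ ∩ V₁).Nonempty ∧ (g^[n] '' U₂ ∩ V₂).Nonempty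

/-- An autonomous map is totally transitive. -/
def MapTotallyTransitive {Y : Type*} [TopologicalSpace Y] (g : Y → Y) : Prop :=
  ∀ k : ℕ, 0 < k → ∀ U V : Set Y, IsOpen U → U.Nonempty → IsOpen V → V.Nonempty →
    ∃ n : ℕ, 0 < n ∧ (g^[n * k] '' U ∩ V).Nonempty

/-- An autonomous map is syndetically transitive. -/
def MapSyndeticallyTransitive {Y : Type*} [TopologicalSpace Y] (g : Y → Y) : Prop :=
  ∀ U V : Set Y, IsOpen U → U.Nonempty → IsOpen V → V.Nonempty →
    SyndeticSet {n : ℕ | 0 < n ∧ (g^[n] '' U ∩ V).Nonempty}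

/-- An autonomous map is minimal. -/
def MapMinimal {Y : Type*} [TopologicalSpace Y] (g : Y → Y) : Prop :=
  ∀ x : Y, Dense (Set.range fun n : ℕ => g^[n] x)

end TopDefs

section MetricDefs

variable {X : Type*} [MetricSpace X]

/-- The compositions `(f_r^k)` converge collectively to `(f^k)` (w.r.t. the supremum metric). -/
def CollectivelyConverges (f : ℕ → X → X) (g : X → X) : Prop :=
  ∀ ε : ℝ, 0 < ε → ∃ r₀ : ℕ, ∀ r : ℕ, r₀ ≤ r → ∀ k : ℕ, 1 ≤ k → ∀ x : X,
    dist (nds f r k x) (g^[k] x) < ε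

/-- `N(U, δ)`: the times at which the NDS is `δ`-sensitive on `U`. -/
def SensSet (f : ℕ → X → X) (U : Set X) (δ : ℝ) : Set ℕ :=
  {n : ℕ | 0 < n ∧ ∃ x ∈ U, ∃ y ∈ U, δ < dist (nds f 1 n x) (nds f 1 n y)}

/-- The NDS `f_{1,∞}` is multi-sensitive. -/
def NDSMultiSensitive (f : ℕ → X → X) : Prop :=
  ∃ δ : ℝ, 0 < δ ∧ ∀ m : ℕ, 0 < m → ∀ U : Fin m → Set X,
    (∀ i, IsOpen (U i)) → (∀ i, (U i).Nonempty) → (⋂ i, SensSet f (U i) δ).Nonempty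

/-- The NDS `f_{1,∞}` is thickly sensitive. -/
def NDSThicklySensitive (f : ℕ → X → X) : Prop :=
  ∃ δ : ℝ, 0 < δ ∧ ∀ U : Set X, IsOpen U → U.Nonempty → ThickSet (SensSet f U δ)

/-- The NDS `f_{1,∞}` is syndetically sensitive. -/
def NDSSyndeticallySensitive (f : ℕ → X → X) : Prop :=
  ∃ δ : ℝ, 0 < δ ∧ ∀ U : Set X, IsOpen U → U.Nonempty → SyndeticSet (SensSet f U δ)

/-- The NDS `f_{1,∞}` is mildly mixing: its product with every transitive NDS on a compact
metric space is transitive. -/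
def NDSMildlyMixing (f : ℕ → X → X) : Prop :=
  ∀ (Y : Type*) [MetricSpace Y] [CompactSpace Y] (g : ℕ → Y → Y),
    (∀ n : ℕ, 1 ≤ n → Continuous (g n)) → NDSTransitive g →
    NDSTransitive (fun n (p : X × Y) => (f n p.1, g n p.2))

/-- The NDS `f_{1,∞}` is Li–Yorke chaotic. -/
def LiYorkeChaotic (f : ℕ → X → X) : Prop :=
  ∃ S : Set X, ¬S.Countable ∧ ∀ x ∈ S, ∀ y ∈ S, x ≠ y →
    Filter.liminf (fun n : ℕ => dist (nds f 1 n x) (nds f 1 n y)) Filter.atTop = 0 ∧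
    0 < Filter.limsup (fun n : ℕ => dist (nds f 1 n x) (nds f 1 n y)) Filter.atTop

end MetricDefs

open scoped Topology

/-- The Kuratowski–Ulam theorem for a countable family of dense open sets. -/
theorem eventually_residual_eventually_residual {X ι : Type*} [TopologicalSpace X]
    [SecondCountableTopology X] [Countable ι] {O : ι → Set (X × X)}
    (ho : ∀ i, IsOpen (O i)) (hd : ∀ i, Dense (O i)) :
    ∀ᶠ x in residual X, ∀ᶠ y in residual X, ∀ i, (x, y) ∈ O i := by
  have hcb := TopologicalSpace.countable_countableBasis X
  have key : ∀ᶠ x in residual X, ∀ i, ∀ B ∈ TopologicalSpace.countableBasis X,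
      ∃ y ∈ B, (x, y) ∈ O i := by
    refine eventually_countable_forall.2 fun i => (eventually_countable_ball hcb).2 fun B hB => ?_
    have hBo := TopologicalSpace.isOpen_of_mem_countableBasis hB
    refine residual_of_dense_open ?_ ?_
    · convert isOpenMap_fst _ ((ho i).inter (isOpen_univ.prod hBo)) using 1
      ext x
      simp [and_comm]
    · refine dense_iff_inter_open.2 fun U hU hUne => ?_
      obtain ⟨⟨x, y⟩, hxy, hx, hy⟩ := (hd i).exists_mem_open (hU.prod hBo)
        (hUne.prod (TopologicalSpace.nonempty_of_mem_countableBasis hB))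
      exact ⟨x, hx, y, hy, hxy⟩
  filter_upwards [key] with x hx
  refine eventually_countable_forall.2 fun i => residual_of_dense_open ?_ ?_
  · exact (ho i).preimage (by fun_prop : Continuous fun y => (x, y))
  · refine (TopologicalSpace.isBasis_countableBasis X).dense_iff.2 fun B hB _ => ?_
    obtain ⟨y, hy, hxy⟩ := hx i B hB
    exact ⟨y, hy, hxy⟩

/-- A countable family of symmetric dense open relations whose intersection is irreflexive admits
an uncountable set of pairwise related points. -/
theorem exists_uncountable_pairwise_mem {X ι : Type*} [TopologicalSpace X]
    [SecondCountableTopology X] [BaireSpace X] [Nonempty X] [Countable ι] {O : ι → Set (X × X)}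
    (ho : ∀ i, IsOpen (O i)) (hd : ∀ i, Dense (O i))
    (hsymm : ∀ i x y, (x, y) ∈ O i → (y, x) ∈ O i) (hirr : ∀ x, ∃ i, (x, x) ∉ O i) :
    ∃ S : Set X, ¬S.Countable ∧ S.Pairwise fun x y => ∀ i, (x, y) ∈ O i := by
  set G : Set X := {x | ∀ᶠ y in residual X, ∀ i, (x, y) ∈ O i} with hG
  have hGres : G ∈ residual X := eventually_residual_eventually_residual ho hd
  obtain ⟨S, ⟨hSG, hSp⟩, hSmax⟩ := zorn_subset
    {S : Set X | S ⊆ G ∧ S.Pairwise fun x y => ∀ i, (x, y) ∈ O i} (by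
      intro c hc hchain
      refine ⟨⋃₀ c, ⟨sUnion_subset fun s hs => (hc hs).1, ?_⟩, fun s hs => subset_sUnion_of_mem hs⟩
      exact hchain.pairwise_sUnion.2 fun s hs => (hc hs).2)
  refine ⟨S, fun hcount => ?_, hSp⟩
  have hev : ∀ᶠ y in residual X, ∀ x ∈ S, ∀ i, (x, y) ∈ O i :=
    (eventually_countable_ball hcount).2 fun x hx => hSG hx
  obtain ⟨y, hyG, hy⟩ := (dense_of_mem_residual (inter_mem hGres hev)).nonempty
  have hyS : y ∉ S := fun h => by
    obtain ⟨i, hi⟩ := hirr y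
    exact hi (hy y h i)
  refine hyS (hSmax ⟨insert_subset hyG hSG, ?_⟩ (subset_insert y S) (mem_insert y S))
  refine hSp.insert fun x hx _ => ⟨fun i => hsymm i _ _ (hy x hx i), hy x hx⟩

theorem nds_add {X : Type*} (f : ℕ → X → X) (i s k : ℕ) (x : X) :
    nds f i (s + k) x = nds f (i + s) k (nds f i s x) := by
  induction k with
  | zero => rfl
  | succ k ih =>
    change f (i + (s + k)) (nds f i (s + k) x) = f (i + s + k) _
    rw [ih, add_assoc]

theorem continuous_nds {X : Type*} [TopologicalSpace X] {f : ℕ → X → X}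
    (hcont : ∀ n : ℕ, 1 ≤ n → Continuous (f n)) (n : ℕ) : Continuous (nds f 1 n) := by
  induction n with
  | zero => exact continuous_id
  | succ n ih => exact (hcont (1 + n) (by omega)).comp ih

theorem surjective_nds {X : Type*} {f : ℕ → X → X}
    (hsurj : ∀ n : ℕ, 1 ≤ n → Function.Surjective (f n)) (n : ℕ) :
    Function.Surjective (nds f 1 n) := by
  induction n with
  | zero => exact Function.surjective_id
  | succ n ih => exact (hsurj (1 + n) (by omega)).comp ih

theorem FeebleOpen.nds {X : Type*} [TopologicalSpace X] {f : ℕ → X → X} (hfo : FeebleOpen f)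
    (n : ℕ) {U : Set X} (hU : IsOpen U) (hne : U.Nonempty) :
    (interior (nds f 1 n '' U)).Nonempty := by
  induction n with
  | zero => simpa [_root_.nds, hU.interior_eq] using hne
  | succ n ih =>
    refine (hfo (1 + n) (by omega) _ isOpen_interior ih).mono (interior_mono ?_)
    rw [_root_.nds, image_comp]
    exact image_mono interior_subset

/-- In a multi-transitive system the common time can be chosen divisible by a given number. -/
theorem NDSMultiTransitive.exists_dvd {X : Type*} [TopologicalSpace X] {f : ℕ → X → X}
    (hmt : NDSMultiTransitive f) {U V : Set X} (hU : IsOpen U) (hUne : U.Nonempty)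
    (hV : IsOpen V) (hVne : V.Nonempty) (m : ℕ) {K : ℕ} (hK : 0 < K) :
    ∃ l : ℕ, 0 < l ∧ K ∣ l ∧ ∀ d : ℕ, 1 ≤ d → d ≤ m → ∃ x ∈ U, nds f 1 (l * d) x ∈ V := by
  obtain ⟨l, hl, h⟩ := hmt ((m + 1) * K) (by positivity) (fun _ => U) (fun _ => V)
    (fun _ => hU) (fun _ => hUne) (fun _ => hV) (fun _ => hVne)
  refine ⟨l * K, by positivity, Dvd.intro_left l rfl, fun d hd1 hdm => ?_⟩
  have hpos : 0 < K * d := by positivity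
  have hlt : K * d - 1 < (m + 1) * K := by nlinarith [Nat.sub_le (K * d) 1]
  obtain ⟨_, ⟨x, hx, rfl⟩, hxV⟩ := h ⟨K * d - 1, hlt⟩
  refine ⟨x, hx, ?_⟩
  have : l * K * d = l * (K * d - 1 + 1) := by rw [Nat.sub_add_cancel hpos, mul_assoc]
  rwa [this]

section Metric

variable {X : Type*} [MetricSpace X] {f : ℕ → X → X} {F : X → X}

theorem CollectivelyConverges.dist_nds_add_lt (hcoll : CollectivelyConverges f F) {ε : ℝ}
    (hε : 0 < ε) : ∃ r : ℕ, ∀ s, r ≤ s → ∀ k, 1 ≤ k → ∀ x : X,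
      dist (nds f 1 (s + k) x) (F^[k] (nds f 1 s x)) < ε := by
  obtain ⟨r, hr⟩ := hcoll ε hε
  refine ⟨r, fun s hs k hk x => ?_⟩
  rw [nds_add]
  exact hr (1 + s) (by omega) k hk _

/-- A nontrivial space carrying a multi-transitive, collectively convergent system has no isolated
points. -/
theorem NDSMultiTransitive.not_isOpen_singleton [Nontrivial X] (hmt : NDSMultiTransitive f)
    (hcoll : CollectivelyConverges f F) (p : X) : ¬IsOpen ({p} : Set X) := by
  intro hp
  obtain ⟨ε, hε, hball⟩ := Metric.isOpen_singleton_iff.1 hp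
  obtain ⟨r, hr⟩ := hcoll.dist_nds_add_lt hε
  set w := nds f 1 r p with hw
  have hit : ∀ K, 0 < K → ∃ l, 0 < l ∧ K ∣ l ∧ nds f 1 l p = p := by
    intro K hK
    obtain ⟨l, hl, hKl, h⟩ := hmt.exists_dvd hp (singleton_nonempty p) hp (singleton_nonempty p)
      1 hK
    obtain ⟨x, rfl, hx⟩ := h 1 le_rfl le_rfl
    exact ⟨l, hl, hKl, by simpa using hx⟩
  have iter : ∀ k, 1 ≤ k → nds f 1 (r + k) p = p → F^[k] w = p := fun k hk h => by
    have := hr r le_rfl k hk p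
    rw [h, dist_comm] at this
    exact hball _ this
  obtain ⟨l₁, hl₁, hd₁, h₁⟩ := hit (r + 1) (by omega)
  have hle₁ := Nat.le_of_dvd hl₁ hd₁
  obtain ⟨k₁, rfl⟩ : ∃ k, l₁ = r + k := ⟨l₁ - r, by omega⟩
  have hF₁ := iter k₁ (by omega) h₁
  obtain ⟨l₂, hl₂, hd₂, h₂⟩ := hit (r + k₁ + 1) (by omega)
  have hle₂ := Nat.le_of_dvd hl₂ hd₂
  obtain ⟨T, rfl⟩ : ∃ T, l₂ = r + (T + k₁) := ⟨l₂ - r - k₁, by omega⟩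
  have hT : 0 < T := by omega
  have hFT : F^[T] p = p := by
    have := iter (T + k₁) (by omega) h₂
    rwa [Function.iterate_add_apply, hF₁] at this
  obtain ⟨l₃, hl₃, hd₃, h₃⟩ := hit (T * (r + 1)) (by positivity)
  have hle₃ : r + 1 ≤ l₃ := Nat.le_of_dvd hl₃ ((Dvd.intro_left T rfl).trans hd₃)
  obtain ⟨q, hq⟩ := exists_ne p
  obtain ⟨l₄, hl₄, hd₄, h₄⟩ := hmt.exists_dvd hp (singleton_nonempty p) isOpen_compl_singleton
    ⟨q, hq⟩ 1 (K := l₃) hl₃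
  obtain ⟨x, rfl, hx⟩ := h₄ 1 le_rfl le_rfl
  rw [mul_one] at hx
  have hle₄ := Nat.le_of_dvd hl₄ hd₄
  have hTl₃ : T ∣ l₃ := (Dvd.intro _ rfl).trans hd₃
  obtain ⟨c, hc⟩ : T ∣ l₄ - l₃ := Nat.dvd_sub (hTl₃.trans hd₄) hTl₃
  have hF₃ := iter (l₃ - r) (by omega) (by rwa [Nat.add_sub_cancel' (by omega)])
  have hF₄ : F^[l₄ - r] w = x := by
    rw [show l₄ - r = T * c + (l₃ - r) by omega, Function.iterate_add_apply, hF₃,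
      Function.iterate_mul]
    exact Function.iterate_fixed hFT c
  have hdist := hr r le_rfl (l₄ - r) (by omega) x
  rw [← hw, hF₄, Nat.add_sub_cancel' (by omega)] at hdist
  exact hx (hball _ hdist)

/-- The limit map of a minimal, collectively convergent system is minimal, with every open set
visited at arbitrarily large times. -/
theorem CollectivelyConverges.exists_iterate_mem [∀ x : X, NeBot (𝓝[≠] x)]
    (hcoll : CollectivelyConverges f F) (hmin : NDSMinimal f)
    (hsurj : ∀ n : ℕ, 1 ≤ n → Function.Surjective (f n)) (y : X) {V : Set X} (hV : IsOpen V)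
    (hVne : V.Nonempty) (K : ℕ) : ∃ k, K ≤ k ∧ F^[k] y ∈ V := by
  obtain ⟨q, hq⟩ := hVne
  obtain ⟨ε, hε, hball⟩ := Metric.isOpen_iff.1 hV q hq
  obtain ⟨r, hr⟩ := hcoll.dist_nds_add_lt (half_pos hε)
  obtain ⟨x, rfl⟩ := surjective_nds hsurj r y
  obtain ⟨_, ⟨⟨n, rfl⟩, hn⟩, hnq⟩ := ((hmin x).sdiff_finite
    ((finite_Iic (r + K)).image fun n => nds f 1 n x)).exists_mem_open
    Metric.isOpen_ball ⟨q, Metric.mem_ball_self (half_pos hε)⟩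
  have hlt : r + K < n := by
    by_contra! h
    exact hn ⟨n, h, rfl⟩
  obtain ⟨k, rfl⟩ : ∃ k, n = r + k := ⟨n - r, by omega⟩
  refine ⟨k, by omega, hball ?_⟩
  have h₁ := hr r le_rfl k (by omega) x
  rw [dist_comm] at h₁
  rw [Metric.mem_ball] at hnq ⊢
  linarith [dist_triangle (F^[k] (nds f 1 r x)) (nds f 1 (r + k) x) q]

/-- If every orbit of a continuous self-map of a compact space visits `W`, then along any
arithmetic progression of times there is a return of `W` to itself among boundedly many terms. -/
theorem exists_bounded_return {Y : Type*} [TopologicalSpace Y] [CompactSpace Y] [Nonempty Y]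
    {F : Y → Y} (hF : Continuous F) {W : Set Y} (hW : IsOpen W) (hvisit : ∀ y, ∃ k, F^[k] y ∈ W) :
    ∃ M : ℕ, ∀ l : ℕ, ∃ d, 1 ≤ d ∧ d ≤ M ∧ ∃ z ∈ W, F^[l * d] z ∈ W := by
  obtain ⟨t, ht⟩ := isCompact_univ.elim_finite_subcover (fun k => F^[k] ⁻¹' W)
    (fun k => hW.preimage (hF.iterate k)) (fun y _ => mem_iUnion.2 (hvisit y))
  have ht' : ∀ y, ∃ k ∈ t, F^[k] y ∈ W := fun y => by simpa using ht (mem_univ y)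
  choose c hct hcW using ht'
  refine ⟨t.card, fun l => ?_⟩
  obtain ⟨x⟩ := ‹Nonempty Y›
  obtain ⟨a, ha, b, hb, hab, hc⟩ := Finset.exists_ne_map_eq_of_card_lt_of_maps_to
    (s := Finset.range (t.card + 1)) (t := t) (by simp)
    (f := fun k => c (F^[l * k] x)) (fun k _ => hct _)
  wlog hlt : a < b generalizing a b
  · exact this b hb a ha hab.symm hc.symm (by omega)
  simp only [Finset.mem_range] at ha hb
  refine ⟨b - a, by omega, by omega, _, hcW (F^[l * a] x), ?_⟩
  have := hcW (F^[l * b] x)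
  rw [← hc, ← Function.iterate_add_apply] at this
  rw [← Function.iterate_add_apply, ← Function.iterate_add_apply]
  convert this using 2
  obtain ⟨e, rfl⟩ : ∃ e, b = a + e := ⟨b - a, by omega⟩
  rw [Nat.add_sub_cancel_left]
  ring

/-- The limit map of a minimal, multi-transitive, collectively convergent system is weakly mixing,
with arbitrarily large common transition times. -/
theorem CollectivelyConverges.exists_iterate_mem_pair [CompactSpace X] [Nonempty X]
    [∀ x : X, NeBot (𝓝[≠] x)] (hcoll : CollectivelyConverges f F) (hmin : NDSMinimal f)
    (hcont : ∀ n : ℕ, 1 ≤ n → Continuous (f n))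
    (hsurj : ∀ n : ℕ, 1 ≤ n → Function.Surjective (f n)) (hF : Continuous F)
    (hmt : NDSMultiTransitive f) {U₁ U₂ V₁ V₂ : Set X}
    (hU₁ : IsOpen U₁) (hU₁ne : U₁.Nonempty) (hU₂ : IsOpen U₂) (hU₂ne : U₂.Nonempty)
    (hV₁ : IsOpen V₁) (hV₁ne : V₁.Nonempty) (hV₂ : IsOpen V₂) (hV₂ne : V₂.Nonempty) (N : ℕ) :
    ∃ n, N ≤ n ∧ (∃ x ∈ U₁, F^[n] x ∈ V₁) ∧ ∃ x ∈ U₂, F^[n] x ∈ V₂ := by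
  obtain ⟨q, hq⟩ := hV₁ne
  obtain ⟨ε, hε, hball⟩ := Metric.isOpen_iff.1 hV₁ q hq
  obtain ⟨r, hr⟩ := hcoll.dist_nds_add_lt (half_pos hε)
  obtain ⟨v, hv⟩ := hV₂ne
  obtain ⟨s, hs, hsU⟩ := hcoll.exists_iterate_mem hmin hsurj v hU₂ hU₂ne r
  have hW : IsOpen (V₂ ∩ F^[s] ⁻¹' U₂) := hV₂.inter (hU₂.preimage (hF.iterate s))
  obtain ⟨M, hM⟩ := exists_bounded_return hF hW fun y =>
    (hcoll.exists_iterate_mem hmin hsurj y hW ⟨v, hv, hsU⟩ 0).imp fun _ h => h.2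
  obtain ⟨l, hl, hdvd, hlM⟩ := hmt.exists_dvd (hU₁.preimage (continuous_nds hcont s))
    (hU₁ne.preimage (surjective_nds hsurj s)) Metric.isOpen_ball
    ⟨q, Metric.mem_ball_self (half_pos hε)⟩ M (K := s + N + 1) (by omega)
  have hle := Nat.le_of_dvd hl hdvd
  obtain ⟨d, hd, hdM, z, hz, hzW⟩ := hM l
  obtain ⟨x, hx, hxq⟩ := hlM d hd hdM
  have hld : l ≤ l * d := Nat.le_mul_of_pos_right l hd
  obtain ⟨n, hn⟩ : ∃ n, l * d = s + n := ⟨l * d - s, by omega⟩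
  rw [hn] at hzW hxq
  refine ⟨n, by omega, ⟨_, hx, hball ?_⟩, _, hz.2, ?_⟩
  · have h₁ := hr s hs n (by omega) x
    rw [dist_comm] at h₁
    rw [Metric.mem_ball] at hxq ⊢
    linarith [dist_triangle (F^[n] (nds f 1 s x)) (nds f 1 (s + n) x) q]
  · rw [← Function.iterate_add_apply, add_comm]
    exact hzW.1

/-- A minimal, multi-transitive, feeble open, collectively convergent system is weakly mixing,
with arbitrarily large common transition times. -/
theorem CollectivelyConverges.exists_nds_mem_pair [CompactSpace X] [Nonempty X]
    [∀ x : X, NeBot (𝓝[≠] x)] (hcoll : CollectivelyConverges f F) (hmin : NDSMinimal f)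
    (hcont : ∀ n : ℕ, 1 ≤ n → Continuous (f n)) (hfo : FeebleOpen f)
    (hsurj : ∀ n : ℕ, 1 ≤ n → Function.Surjective (f n)) (hF : Continuous F)
    (hmt : NDSMultiTransitive f) {U₁ U₂ : Set X}
    (hU₁ : IsOpen U₁) (hU₁ne : U₁.Nonempty) (hU₂ : IsOpen U₂) (hU₂ne : U₂.Nonempty)
    (a b : X) {ε : ℝ} (hε : 0 < ε) (N : ℕ) :
    ∃ n, N ≤ n ∧ (∃ x ∈ U₁, dist (nds f 1 n x) a < ε) ∧ ∃ y ∈ U₂, dist (nds f 1 n y) b < ε := by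
  obtain ⟨r, hr⟩ := hcoll.dist_nds_add_lt (half_pos hε)
  obtain ⟨n, hn, ⟨x', hx', hxa⟩, y', hy', hyb⟩ :=
    hcoll.exists_iterate_mem_pair hmin hcont hsurj hF hmt
      isOpen_interior (hfo.nds r hU₁ hU₁ne) isOpen_interior (hfo.nds r hU₂ hU₂ne)
      Metric.isOpen_ball ⟨a, Metric.mem_ball_self (half_pos hε)⟩
      Metric.isOpen_ball ⟨b, Metric.mem_ball_self (half_pos hε)⟩ (N + 1)
  obtain ⟨x, hx, rfl⟩ := interior_subset hx'
  obtain ⟨y, hy, rfl⟩ := interior_subset hy'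
  rw [Metric.mem_ball] at hxa hyb
  refine ⟨r + n, by omega, ⟨x, hx, ?_⟩, y, hy, ?_⟩
  · linarith [hr r le_rfl n (by omega) x,
      dist_triangle (nds f 1 (r + n) x) (F^[n] (nds f 1 r x)) a]
  · linarith [hr r le_rfl n (by omega) y,
      dist_triangle (nds f 1 (r + n) y) (F^[n] (nds f 1 r y)) b]

/-- Weak mixing with arbitrarily large times forces Li–Yorke chaos. -/
theorem LiYorkeChaotic.of_exists_nds_mem_pair [CompactSpace X] [Nontrivial X]
    (hcont : ∀ n : ℕ, 1 ≤ n → Continuous (f n))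
    (hwm : ∀ U₁ U₂ : Set X, IsOpen U₁ → U₁.Nonempty → IsOpen U₂ → U₂.Nonempty →
      ∀ (a b : X) (ε : ℝ), 0 < ε → ∀ N : ℕ, ∃ n, N ≤ n ∧
        (∃ x ∈ U₁, dist (nds f 1 n x) a < ε) ∧ ∃ y ∈ U₂, dist (nds f 1 n y) b < ε) :
    LiYorkeChaotic f := by
  obtain ⟨a, b, hab⟩ := exists_pair_ne X
  have hδ : 0 < dist a b / 3 := by linarith [dist_pos.2 hab]
  set δ := dist a b / 3 with hδdef
  have hcd : ∀ n, Continuous fun p : X × X => dist (nds f 1 n p.1) (nds f 1 n p.2) := fun n =>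
    ((continuous_nds hcont n).comp continuous_fst).dist
      ((continuous_nds hcont n).comp continuous_snd)
  let O : ℕ ⊕ ℕ → Set (X × X) := Sum.elim
    (fun N => {p | ∃ n, N ≤ n ∧ dist (nds f 1 n p.1) (nds f 1 n p.2) < 1 / ((N : ℝ) + 1)})
    (fun N => {p | ∃ n, N ≤ n ∧ δ < dist (nds f 1 n p.1) (nds f 1 n p.2)})
  have hO : ∀ i, IsOpen (O i) := by
    rintro (N | N)
    · simp only [O, Sum.elim_inl, ← exists_prop, ofPred_exists]
      exact isOpen_iUnion fun n => isOpen_iUnion fun _ => isOpen_lt (hcd n) continuous_const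
    · simp only [O, Sum.elim_inr, ← exists_prop, ofPred_exists]
      exact isOpen_iUnion fun n => isOpen_iUnion fun _ => isOpen_lt continuous_const (hcd n)
  have hdense : ∀ i, Dense (O i) := by
    intro i
    refine dense_iff_inter_open.2 fun W hW ⟨⟨u, v⟩, huv⟩ => ?_
    obtain ⟨U, V, hU, hV, hu, hv, hUV⟩ := isOpen_prod_iff.1 hW u v huv
    obtain N | N := i
    · have hpos : 0 < 1 / ((N : ℝ) + 1) := by positivity
      obtain ⟨n, hn, ⟨x, hx, hxa⟩, y, hy, hya⟩ :=
        hwm U V hU ⟨u, hu⟩ hV ⟨v, hv⟩ a a _ (half_pos hpos) N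
      refine ⟨(x, y), hUV ⟨hx, hy⟩, n, hn, ?_⟩
      change dist (nds f 1 n x) (nds f 1 n y) < _
      linarith [dist_triangle_right (nds f 1 n x) (nds f 1 n y) a]
    · obtain ⟨n, hn, ⟨x, hx, hxa⟩, y, hy, hyb⟩ := hwm U V hU ⟨u, hu⟩ hV ⟨v, hv⟩ a b _ hδ N
      refine ⟨(x, y), hUV ⟨hx, hy⟩, n, hn, ?_⟩
      change δ < dist (nds f 1 n x) (nds f 1 n y)
      rw [dist_comm] at hxa
      linarith [dist_triangle4 a (nds f 1 n x) (nds f 1 n y) b]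
  obtain ⟨S, hS, hpair⟩ := exists_uncountable_pairwise_mem hO hdense
    (by rintro (N | N) x y ⟨n, hn, h⟩ <;> exact ⟨n, hn, by rwa [dist_comm]⟩)
    (fun x => ⟨Sum.inr 0, by rintro ⟨n, -, h⟩; simp only [dist_self] at h; linarith⟩)
  refine ⟨S, hS, fun x hx y hy hxy => ?_⟩
  have hbddBelow : IsBoundedUnder (· ≥ ·) atTop
      fun n => dist (nds f 1 n x) (nds f 1 n y) := isBoundedUnder_of ⟨0, fun _ => dist_nonneg⟩
  have hbddAbove : IsBoundedUnder (· ≤ ·) atTop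
      fun n => dist (nds f 1 n x) (nds f 1 n y) := isBoundedUnder_of ⟨Metric.diam (univ : Set X),
    fun _ => Metric.dist_le_diam_of_mem isCompact_univ.isBounded (mem_univ _) (mem_univ _)⟩
  refine ⟨le_antisymm (le_of_forall_pos_le_add fun ε hε => ?_) ?_, hδ.trans_le ?_⟩
  · refine liminf_le_of_frequently_le (frequently_atTop.2 fun N => ?_) hbddBelow
    obtain ⟨K, hK⟩ := exists_nat_one_div_lt hε
    obtain ⟨n, hn, h⟩ := hpair hx hy hxy (Sum.inl (max N K))
    refine ⟨n, le_of_max_le_left hn, ?_⟩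
    have : 1 / (((max N K : ℕ) : ℝ) + 1) ≤ 1 / ((K : ℝ) + 1) :=
      one_div_le_one_div_of_le (by positivity) (by gcongr; exact le_max_right N K)
    change dist (nds f 1 n x) (nds f 1 n y) < _ at h
    linarith
  · exact le_liminf_of_le hbddAbove.isCoboundedUnder_ge (Eventually.of_forall fun _ => dist_nonneg)
  · refine le_limsup_of_frequently_le (frequently_atTop.2 fun N => ?_) hbddAbove
    obtain ⟨n, hn, h⟩ := hpair hx hy hxy (Sum.inr N)
    exact ⟨n, hn, le_of_lt h⟩

end Metric

theorem multiTransitive_liYorke {X : Type*} [MetricSpace X] [CompactSpace X] [Nontrivial X]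
    (f : ℕ → X → X) (F : X → X)
    (hcont : ∀ n : ℕ, 1 ≤ n → Continuous (f n))
    (hfo : FeebleOpen f)
    (hsurj : ∀ n : ℕ, 1 ≤ n → Function.Surjective (f n))
    (hF : Continuous F)
    (hunif : TendstoUniformly (fun n x => f n x) F Filter.atTop)
    (hcoll : CollectivelyConverges f F)
    (hmin : NDSMinimal f)
    (hmt : NDSMultiTransitive f) :
    LiYorkeChaotic f := by
  have hperf : ∀ x : X, NeBot (𝓝[≠] x) := fun x =>
    neBot_iff.2 fun h => hmt.not_isOpen_singleton hcoll x ((isOpen_singleton_iff_punctured_nhds x).2 h)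
  exact LiYorkeChaotic.of_exists_nds_mem_pair hcont fun U₁ U₂ h₁ h₁' h₂ h₂' a b ε hε N =>
    hcoll.exists_nds_mem_pair hmin hcont hfo hsurj hF hmt h₁ h₁' h₂ h₂' a b hε N
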